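/- arXiv:2403.05450 — 6 statements merged into one kernel-verified Lean document; each statement's English description precedes it below -/
import Mathlib

section
/- The camera kinematics are equivariant: for every X = (S,Q,r) ∈ G, every ξ = (R,x) ∈ M and every u = (Ω,v) ∈ ℝ³ × ℝ³, one has (Qᵀ(RΩ^×)S, r⁻¹Qᵀ(Rv)) = f(φ(X,ξ), ψ(X,u)), i.e. Qᵀ(RΩ^×)S = (QᵀRS)(SᵀΩ)^× and r⁻¹Qᵀ(Rv) = (QᵀRS)(r⁻¹Sᵀv). -/
open Matrix

/-- `SO(3)`: real 3×3 matrices with `RᵀR = I` and `det R = 1`. -/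
def SO3 (R : Matrix (Fin 3) (Fin 3) ℝ) : Prop := Rᵀ * R = 1 ∧ R.det = 1

/-- The skew-symmetric matrix `a^×` with `a^× b = a × b`. -/
def skew (a : Fin 3 → ℝ) : Matrix (Fin 3) (Fin 3) ℝ :=
  !![0, -a 2, a 1; a 2, 0, -a 0; -a 1, a 0, 0]

theorem transpose_mul_skew_mulVec_mul (M : Matrix (Fin 3) (Fin 3) ℝ) (a : Fin 3 → ℝ) :
    Mᵀ * skew (M *ᵥ a) * M = M.det • skew a := by
  ext i j
  fin_cases i <;> fin_cases j <;>
    simp [skew, Matrix.mul_apply, Matrix.mulVec, dotProduct, Fin.sum_univ_three,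
      Matrix.det_fin_three] <;> ring

theorem SO3.mul_transpose {S : Matrix (Fin 3) (Fin 3) ℝ} (hS : SO3 S) : S * Sᵀ = 1 :=
  mul_eq_one_comm.mp hS.1

theorem SO3.skew_mul {S : Matrix (Fin 3) (Fin 3) ℝ} (hS : SO3 S) (a : Fin 3 → ℝ) :
    skew a * S = S * skew (Sᵀ *ᵥ a) := by
  have h := transpose_mul_skew_mulVec_mul S (Sᵀ *ᵥ a)
  rw [mulVec_mulVec, hS.mul_transpose, one_mulVec, hS.2, one_smul] at h
  rw [← h, Matrix.mul_assoc Sᵀ, ← Matrix.mul_assoc S, hS.mul_transpose, Matrix.one_mul]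

theorem stmt5_kinematics_equivariant
    (S Q R : Matrix (Fin 3) (Fin 3) ℝ) (r : ℝ) (x Ω v : Fin 3 → ℝ)
    (hS : SO3 S) (hQ : SO3 Q) (hr : 0 < r) (hR : SO3 R) (hx : x ≠ 0) :
    Qᵀ * (R * skew Ω) * S = (Qᵀ * R * S) * skew (Sᵀ *ᵥ Ω) ∧
    r⁻¹ • (Qᵀ *ᵥ (R *ᵥ v)) = (Qᵀ * R * S) *ᵥ (r⁻¹ • (Sᵀ *ᵥ v)) := by
  constructor
  · rw [Matrix.mul_assoc, Matrix.mul_assoc R, hS.skew_mul]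
    simp only [Matrix.mul_assoc]
  · rw [mulVec_smul, mulVec_mulVec, mulVec_mulVec, Matrix.mul_assoc (Qᵀ * R),
      hS.mul_transpose, Matrix.mul_one]
end

section
/- The epipolar measurement is invariant under the actions φ and θ: for every X = (S,Q,r) ∈ G, every ξ = (R,x) with R ∈ SO(3) and x ≠ 0, and all unit vectors p̊, p ∈ ℝ³, one has h(φ(X,ξ); θ(X,(p̊,p))) = h(ξ; (p̊,p)), i.e. (Qᵀp̊)ᵀ ((r⁻¹Qᵀx)/|r⁻¹Qᵀx|)^× (QᵀRS)(Sᵀp) = p̊ᵀ (x/|x|)^× R p. -/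
open Matrix

/-- The Euclidean norm of a vector in `ℝ³`. -/
noncomputable def enorm3 (x : Fin 3 → ℝ) : ℝ := Real.sqrt (x ⬝ᵥ x)

/-- The epipolar measurement `h((R,x);(p̊,p)) = p̊ᵀ (x/|x|)^× R p`. -/
noncomputable def hMeas (R : Matrix (Fin 3) (Fin 3) ℝ) (x pr p : Fin 3 → ℝ) : ℝ :=
  pr ⬝ᵥ (skew ((enorm3 x)⁻¹ • x) *ᵥ (R *ᵥ p))

/-- The scalar triple product scales by the determinant under a linear map. -/
theorem dotProduct_skew_mulVec (M : Matrix (Fin 3) (Fin 3) ℝ) (a b c : Fin 3 → ℝ) :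
    (M *ᵥ a) ⬝ᵥ (skew (M *ᵥ b) *ᵥ (M *ᵥ c)) = M.det * (a ⬝ᵥ (skew b *ᵥ c)) := by
  simp [skew, Matrix.det_fin_three, Matrix.mulVec, dotProduct, Fin.sum_univ_three]
  ring

theorem enorm3_smul {t : ℝ} (ht : 0 ≤ t) (x : Fin 3 → ℝ) :
    enorm3 (t • x) = t * enorm3 x := by
  rw [enorm3, enorm3, smul_dotProduct, dotProduct_smul, smul_eq_mul, smul_eq_mul, ← mul_assoc,
    Real.sqrt_mul (mul_self_nonneg t), Real.sqrt_mul_self ht]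

theorem enorm3_mulVec {M : Matrix (Fin 3) (Fin 3) ℝ} (hM : Mᵀ * M = 1) (x : Fin 3 → ℝ) :
    enorm3 (M *ᵥ x) = enorm3 x := by
  rw [enorm3, enorm3, dotProduct_mulVec, vecMul_mulVec, ← mulVec_transpose]
  simp [hM]

theorem stmt6_measurement_invariant
    (S Q R : Matrix (Fin 3) (Fin 3) ℝ) (r : ℝ) (x pr p : Fin 3 → ℝ)
    (hS : SO3 S) (hQ : SO3 Q) (hr : 0 < r) (hR : SO3 R) (hx : x ≠ 0)
    (hpr : enorm3 pr = 1) (hp : enorm3 p = 1) :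
    hMeas (Qᵀ * R * S) (r⁻¹ • (Qᵀ *ᵥ x)) (Qᵀ *ᵥ pr) (Sᵀ *ᵥ p)
      = hMeas R x pr p := by
  have hSS : S * Sᵀ = 1 := mul_eq_one_comm.mp hS.1
  have hQQ : Qᵀᵀ * Qᵀ = 1 := by simpa using mul_eq_one_comm.mp hQ.1
  have hp' : (Qᵀ * R * S) *ᵥ (Sᵀ *ᵥ p) = Qᵀ *ᵥ (R *ᵥ p) := by
    rw [mulVec_mulVec, mul_assoc, hSS, mul_one, mulVec_mulVec]
  have hx' : (enorm3 (r⁻¹ • (Qᵀ *ᵥ x)))⁻¹ • r⁻¹ • (Qᵀ *ᵥ x) = Qᵀ *ᵥ ((enorm3 x)⁻¹ • x) := by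
    rw [enorm3_smul (inv_nonneg.mpr hr.le), enorm3_mulVec hQQ, mulVec_smul, smul_smul, mul_inv,
      inv_inv, mul_right_comm, mul_inv_cancel₀ hr.ne', one_mul]
  rw [hMeas, hMeas, hp', hx', dotProduct_skew_mulVec, det_transpose, hQ.2, one_mul]
end

section
/- The map Λ is a lift of the kinematics: for every R ∈ SO(3), x ∈ ℝ³ \ {0} and Ω, v ∈ ℝ³, writing (s,q,b) = Λ((R,x),(Ω,v)), one has the matrix identities −qR + Rs = RΩ^× and −(bI₃ + q)x = Rv. -/
open Matrix

/-- The lift `Λ((R,x),(Ω,v)) = (s, q, b)`. -/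
noncomputable def liftLambda (R : Matrix (Fin 3) (Fin 3) ℝ) (x Ω v : Fin 3 → ℝ) :
    Matrix (Fin 3) (Fin 3) ℝ × Matrix (Fin 3) (Fin 3) ℝ × ℝ :=
  (skew (Ω - (x ⬝ᵥ x)⁻¹ • (skew (Rᵀ *ᵥ x) *ᵥ v)),
   -((x ⬝ᵥ x)⁻¹ • skew (skew x *ᵥ (R *ᵥ v))),
   -(x ⬝ᵥ (R *ᵥ v)) / (x ⬝ᵥ x))

theorem SO3.skew_mulVec_mul {R : Matrix (Fin 3) (Fin 3) ℝ} (hR : SO3 R) (a : Fin 3 → ℝ) :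
    skew (R *ᵥ a) * R = R * skew a := by
  have hRt : R * Rᵀ = 1 := mul_eq_one_comm.mp hR.1
  have h := congrArg (R * ·) (transpose_mul_skew_mulVec_mul R a)
  simpa only [hR.2, one_smul, ← Matrix.mul_assoc, hRt, Matrix.one_mul] using h

theorem SO3.mulVec_skew_mulVec {R : Matrix (Fin 3) (Fin 3) ℝ} (hR : SO3 R) (a b : Fin 3 → ℝ) :
    R *ᵥ (skew a *ᵥ b) = skew (R *ᵥ a) *ᵥ (R *ᵥ b) := by
  rw [Matrix.mulVec_mulVec, Matrix.mulVec_mulVec, hR.skew_mulVec_mul]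

theorem skew_sub (a b : Fin 3 → ℝ) : skew (a - b) = skew a - skew b := by
  ext i j
  fin_cases i <;> fin_cases j <;> simp [skew] <;> ring

theorem skew_smul (c : ℝ) (a : Fin 3 → ℝ) : skew (c • a) = c • skew a := by
  ext i j
  fin_cases i <;> fin_cases j <;> simp [skew]

theorem skew_skew_mulVec_mulVec_self (x w : Fin 3 → ℝ) :
    skew (skew x *ᵥ w) *ᵥ x = (x ⬝ᵥ x) • w - (x ⬝ᵥ w) • x := by
  ext i
  fin_cases i <;>
    simp [skew, Matrix.mulVec, dotProduct, Fin.sum_univ_three] <;> ring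

theorem stmt8_lift
    (R : Matrix (Fin 3) (Fin 3) ℝ) (x Ω v : Fin 3 → ℝ)
    (hR : SO3 R) (hx : x ≠ 0) :
    -(liftLambda R x Ω v).2.1 * R + R * (liftLambda R x Ω v).1 = R * skew Ω ∧
    -(((liftLambda R x Ω v).2.2 • (1 : Matrix (Fin 3) (Fin 3) ℝ)
        + (liftLambda R x Ω v).2.1) *ᵥ x) = R *ᵥ v := by
  constructor
  · have hRt : R * Rᵀ = 1 := mul_eq_one_comm.mp hR.1
    have h := hR.skew_mulVec_mul (skew (Rᵀ *ᵥ x) *ᵥ v)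
    rw [hR.mulVec_skew_mulVec, Matrix.mulVec_mulVec x, hRt, Matrix.one_mulVec] at h
    simp only [liftLambda, neg_neg, skew_sub, skew_smul, Matrix.smul_mul, Matrix.mul_sub,
      Matrix.mul_smul, h]
    abel
  · have hxx : x ⬝ᵥ x ≠ 0 := fun h => hx (dotProduct_self_eq_zero.mp h)
    simp only [liftLambda, Matrix.add_mulVec, Matrix.neg_mulVec, Matrix.smul_mulVec,
      Matrix.one_mulVec, skew_skew_mulVec_mulVec_self]
    ext i
    simp only [Pi.neg_apply, Pi.add_apply, Pi.sub_apply, Pi.smul_apply, smul_eq_mul]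
    field_simp
    ring
end

section
/- The lift Λ is equivariant: for every X = (S,Q,r) ∈ G, every R ∈ SO(3), x ∈ ℝ³ \ {0} and Ω, v ∈ ℝ³, writing (s,q,b) = Λ((R,x),(Ω,v)), one has (Sᵀ s S, Qᵀ q Q, b) = Λ(φ(X,(R,x)), ψ(X,(Ω,v))), i.e. the Adjoint of X⁻¹ applied componentwise to Λ(ξ,u) equals Λ at the transformed state and velocity. -/
open Matrix

theorem SO3.skew_transpose_mulVec {S : Matrix (Fin 3) (Fin 3) ℝ} (hS : SO3 S) (a : Fin 3 → ℝ) :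
    skew (Sᵀ *ᵥ a) = Sᵀ * skew a * S := by
  have h := transpose_mul_skew_mulVec_mul S (Sᵀ *ᵥ a)
  rw [mulVec_mulVec, hS.mul_transpose, one_mulVec, hS.2, one_smul] at h
  exact h.symm

theorem SO3.skew_transpose_mulVec_mulVec {S : Matrix (Fin 3) (Fin 3) ℝ} (hS : SO3 S)
    (a b : Fin 3 → ℝ) : skew (Sᵀ *ᵥ a) *ᵥ (Sᵀ *ᵥ b) = Sᵀ *ᵥ (skew a *ᵥ b) := by
  rw [hS.skew_transpose_mulVec, mulVec_mulVec, Matrix.mul_assoc, hS.mul_transpose,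
    Matrix.mul_one, mulVec_mulVec]

theorem SO3.transpose_mulVec_dotProduct {S : Matrix (Fin 3) (Fin 3) ℝ} (hS : SO3 S)
    (a b : Fin 3 → ℝ) : (Sᵀ *ᵥ a) ⬝ᵥ (Sᵀ *ᵥ b) = a ⬝ᵥ b := by
  rw [dotProduct_mulVec, vecMul_transpose, mulVec_mulVec, hS.mul_transpose, one_mulVec]

theorem stmt9_lift_equivariant
    (S Q R : Matrix (Fin 3) (Fin 3) ℝ) (r : ℝ) (x Ω v : Fin 3 → ℝ)
    (hS : SO3 S) (hQ : SO3 Q) (hr : 0 < r) (hR : SO3 R) (hx : x ≠ 0) :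
    (Sᵀ * (liftLambda R x Ω v).1 * S,
     Qᵀ * (liftLambda R x Ω v).2.1 * Q,
     (liftLambda R x Ω v).2.2)
      = liftLambda (Qᵀ * R * S) (r⁻¹ • (Qᵀ *ᵥ x))
          (Sᵀ *ᵥ Ω) (r⁻¹ • (Sᵀ *ᵥ v)) := by
  have h0 : x ⬝ᵥ x ≠ 0 := fun h => hx (dotProduct_self_eq_zero.mp h)
  have hxx : (r⁻¹ • (Qᵀ *ᵥ x)) ⬝ᵥ (r⁻¹ • (Qᵀ *ᵥ x)) = (r⁻¹ * r⁻¹) * (x ⬝ᵥ x) := by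
    simp only [smul_dotProduct, dotProduct_smul, hQ.transpose_mulVec_dotProduct, smul_eq_mul,
      mul_assoc]
  have hscale : (r⁻¹ * r⁻¹ * (x ⬝ᵥ x))⁻¹ * (r⁻¹ * r⁻¹) = (x ⬝ᵥ x)⁻¹ := by
    field_simp
  have hRv : (Qᵀ * R * S) *ᵥ (r⁻¹ • (Sᵀ *ᵥ v)) = r⁻¹ • (Qᵀ *ᵥ (R *ᵥ v)) := by
    rw [mulVec_smul, mulVec_mulVec, Matrix.mul_assoc, hS.mul_transpose, Matrix.mul_one,
      mulVec_mulVec]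
  have hRx : (Qᵀ * R * S)ᵀ *ᵥ (r⁻¹ • (Qᵀ *ᵥ x)) = r⁻¹ • (Sᵀ *ᵥ (Rᵀ *ᵥ x)) := by
    rw [mulVec_smul, mulVec_mulVec, mulVec_mulVec, transpose_mul, transpose_mul,
      transpose_transpose, Matrix.mul_assoc, Matrix.mul_assoc, hQ.mul_transpose, Matrix.mul_one]
  simp only [liftLambda, hxx, hRv, hRx]
  refine Prod.ext ?_ (Prod.ext ?_ ?_)
  · simp only [skew_smul, smul_mulVec, mulVec_smul, hS.skew_transpose_mulVec_mulVec, smul_smul,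
      ← mul_assoc]
    rw [mul_assoc _ r⁻¹ r⁻¹, hscale, ← hS.skew_transpose_mulVec, mulVec_sub, mulVec_smul]
  · simp only [skew_smul, smul_mulVec, mulVec_smul, hQ.skew_transpose_mulVec_mulVec, smul_smul,
      ← mul_assoc]
    rw [mul_assoc _ r⁻¹ r⁻¹, hscale, hQ.skew_transpose_mulVec, Matrix.mul_neg, Matrix.neg_mul,
      Matrix.mul_smul, Matrix.smul_mul]
  · simp only [smul_dotProduct, dotProduct_smul, hQ.transpose_mulVec_dotProduct, smul_eq_mul]
    field_simp
end

section
/- For every v = (v₁,v₂,v₃)ᵀ ∈ ℝ³, the 10×6 matrix M̄(v) satisfies det(M̄(v)ᵀM̄(v)) = (1 + |e₃ × v|²)² (1 + v₃²) |e₃ × v|², where |e₃ × v|² = v₁² + v₂²; in particular det(M̄(v)ᵀM̄(v)) ≥ |e₃ × v|². -/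
open Matrix

/-- The 10×6 observability test matrix `M̄(v)` with row blocks
`[I₃ 0 0]`, `[0 I₂ 0]`, `[(e₃^×v)^× 0 0]`, `[0 v₃I₂ (v₂,−v₁)ᵀ]`.
Here `e₃ × v = (−v₂, v₁, 0)` and `(e₃^×v)^× = !![0,0,v₁; 0,0,v₂; −v₁,−v₂,0]`. -/
def Mbar (v : Fin 3 → ℝ) : Matrix (Fin 10) (Fin 6) ℝ :=
  !![1, 0, 0, 0, 0, 0;
     0, 1, 0, 0, 0, 0;
     0, 0, 1, 0, 0, 0;
     0, 0, 0, 1, 0, 0;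
     0, 0, 0, 0, 1, 0;
     0, 0, v 0, 0, 0, 0;
     0, 0, v 1, 0, 0, 0;
     -(v 0), -(v 1), 0, 0, 0, 0;
     0, 0, 0, v 2, 0, v 1;
     0, 0, 0, 0, v 2, -(v 0)]

/-- The Gram matrix of the columns of `Mbar v`. -/
theorem Mbar_transpose_mul_self (v : Fin 3 → ℝ) :
    (Mbar v)ᵀ * Mbar v =
      !![1 + v 0 ^ 2, v 0 * v 1, 0, 0, 0, 0;
         v 0 * v 1, 1 + v 1 ^ 2, 0, 0, 0, 0;
         0, 0, 1 + v 0 ^ 2 + v 1 ^ 2, 0, 0, 0;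
         0, 0, 0, 1 + v 2 ^ 2, 0, v 2 * v 1;
         0, 0, 0, 0, 1 + v 2 ^ 2, -(v 2 * v 0);
         0, 0, 0, v 2 * v 1, -(v 2 * v 0), v 0 ^ 2 + v 1 ^ 2] := by
  ext i j
  fin_cases i <;> fin_cases j <;>
    simp [Mbar, Matrix.mul_apply, Fin.sum_univ_succ] <;> ring

theorem det_Mbar_transpose_mul_self (v : Fin 3 → ℝ) :
    ((Mbar v)ᵀ * Mbar v).det =
      (1 + (v 0 ^ 2 + v 1 ^ 2)) ^ 2 * (1 + v 2 ^ 2) * (v 0 ^ 2 + v 1 ^ 2) := by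
  rw [Mbar_transpose_mul_self]
  simp [Matrix.det_succ_row_zero, Fin.sum_univ_succ, Fin.succAbove]
  ring

theorem stmt14_det_Mbar (v : Fin 3 → ℝ) :
    ((Mbar v)ᵀ * Mbar v).det
        = (1 + ((v 0) ^ 2 + (v 1) ^ 2)) ^ 2 * (1 + (v 2) ^ 2)
            * ((v 0) ^ 2 + (v 1) ^ 2) ∧
    ((Mbar v)ᵀ * Mbar v).det ≥ (v 0) ^ 2 + (v 1) ^ 2 := by
  refine ⟨det_Mbar_transpose_mul_self v, ?_⟩
  rw [det_Mbar_transpose_mul_self]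
  refine le_mul_of_one_le_left (by positivity) (one_le_mul_of_one_le_of_one_le ?_ ?_)
  · exact one_le_pow₀ (le_add_of_nonneg_right (by positivity))
  · exact le_add_of_nonneg_right (sq_nonneg _)
end

section
/- Persistence of excitation yields excitation of the observability test matrix: let t ∈ ℝ, δ, μ > 0, and let Q, S : [t, t+δ] → SO(3), x : [t, t+δ] → ℝ³ \ {0} and v : [t, t+δ] → ℝ³ be continuous with Q(s)x(s) = |x(s)|e₃ for all s. Set R(s) := Q(s)ᵀS(s) and v̊(s) := S(s)v(s)/|x(s)|. If (1/δ)∫ₜ^{t+δ} (R(s)v(s))ᵀ Π_{x(s)} (R(s)v(s)) / |x(s)|² ds ≥ μ, then (1/δ)∫ₜ^{t+δ} det(M̄(v̊(s))ᵀ M̄(v̊(s))) ds ≥ μ. -/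
open Matrix

/-- The orthogonal projector onto the plane orthogonal to `u`: `Π_u = I₃ − uuᵀ/|u|²`. -/
noncomputable def projPerp (u : Fin 3 → ℝ) : Matrix (Fin 3) (Fin 3) ℝ :=
  (1 : Matrix (Fin 3) (Fin 3) ℝ) - (u ⬝ᵥ u)⁻¹ • vecMulVec u u

/-- `e₃ = (0,0,1)ᵀ`. -/
def e3 : Fin 3 → ℝ := ![0, 0, 1]

theorem det_gram_Mbar (v : Fin 3 → ℝ) :
    ((Mbar v)ᵀ * Mbar v).det =
      (1 + (v 0 ^ 2 + v 1 ^ 2)) ^ 2 * ((1 + v 2 ^ 2) * (v 0 ^ 2 + v 1 ^ 2)) := by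
  have hgram : (Mbar v)ᵀ * Mbar v =
      !![1 + v 0 ^ 2, v 0 * v 1, 0, 0, 0, 0;
         v 0 * v 1, 1 + v 1 ^ 2, 0, 0, 0, 0;
         0, 0, 1 + (v 0 ^ 2 + v 1 ^ 2), 0, 0, 0;
         0, 0, 0, 1 + v 2 ^ 2, 0, v 2 * v 1;
         0, 0, 0, 0, 1 + v 2 ^ 2, -(v 2 * v 0);
         0, 0, 0, v 2 * v 1, -(v 2 * v 0), v 0 ^ 2 + v 1 ^ 2] := by
    ext i j
    fin_cases i <;> fin_cases j <;>
      simp [Mbar, Matrix.mul_apply, Fin.sum_univ_succ] <;> ring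
  have hblock : (Mbar v)ᵀ * Mbar v =
      Matrix.reindex finSumFinEquiv finSumFinEquiv
        (Matrix.fromBlocks
          !![1 + v 0 ^ 2, v 0 * v 1, 0; v 0 * v 1, 1 + v 1 ^ 2, 0;
             0, 0, 1 + (v 0 ^ 2 + v 1 ^ 2)] 0 0
          !![1 + v 2 ^ 2, 0, v 2 * v 1; 0, 1 + v 2 ^ 2, -(v 2 * v 0);
             v 2 * v 1, -(v 2 * v 0), v 0 ^ 2 + v 1 ^ 2]) := by
    rw [hgram]
    ext i j
    fin_cases i <;> fin_cases j <;> rfl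
  rw [hblock, Matrix.det_reindex_self, Matrix.det_fromBlocks_zero₂₁, Matrix.det_fin_three,
    Matrix.det_fin_three]
  simp
  ring

theorem dotProduct_self_pos {x : Fin 3 → ℝ} (hx : x ≠ 0) : 0 < x ⬝ᵥ x := by
  simpa using Matrix.dotProduct_star_self_pos_iff.2 hx

theorem dotProduct_projPerp_mulVec (u z : Fin 3 → ℝ) :
    z ⬝ᵥ (projPerp u *ᵥ z) = z ⬝ᵥ z - (u ⬝ᵥ u)⁻¹ * (u ⬝ᵥ z) ^ 2 := by
  rw [projPerp, sub_mulVec, one_mulVec, smul_mulVec, vecMulVec_mulVec, dotProduct_sub]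
  simp only [op_smul_eq_smul, dotProduct_smul, smul_eq_mul, dotProduct_comm z u]
  ring

/-- In the frame that sends `x` to `|x| e₃`, projecting orthogonally to `x` keeps the first two
coordinates. -/
theorem dotProduct_projPerp_div_eq {Q : Matrix (Fin 3) (Fin 3) ℝ} {x : Fin 3 → ℝ}
    (hQ : SO3 Q) (hx : x ≠ 0) (hQx : Q *ᵥ x = enorm3 x • e3) (w : Fin 3 → ℝ) :
    ((Qᵀ *ᵥ w) ⬝ᵥ (projPerp x *ᵥ (Qᵀ *ᵥ w))) / (x ⬝ᵥ x) =
      ((enorm3 x)⁻¹ • w) 0 ^ 2 + ((enorm3 x)⁻¹ • w) 1 ^ 2 := by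
  have hpos := dotProduct_self_pos hx
  have hsq : enorm3 x ^ 2 = x ⬝ᵥ x := Real.sq_sqrt hpos.le
  have hne : enorm3 x ≠ 0 := (Real.sqrt_pos.2 hpos).ne'
  have hnorm : (Qᵀ *ᵥ w) ⬝ᵥ (Qᵀ *ᵥ w) = w ⬝ᵥ w := by
    rw [dotProduct_mulVec, vecMul_transpose, mulVec_mulVec, mul_eq_one_comm.1 hQ.1, one_mulVec]
  have hdot : x ⬝ᵥ (Qᵀ *ᵥ w) = enorm3 x * w 2 := by
    rw [dotProduct_mulVec, vecMul_transpose, hQx]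
    simp only [e3, vec3_dotProduct, Pi.smul_apply, smul_eq_mul, cons_val]
    ring
  rw [dotProduct_projPerp_mulVec, hnorm, hdot, ← hsq, vec3_dotProduct]
  simp only [Pi.smul_apply, smul_eq_mul]
  field_simp
  ring

theorem continuous_enorm3 : Continuous enorm3 := by
  unfold enorm3
  fun_prop

theorem stmt16_pe_implies_excitation
    (t δ μ : ℝ) (hδ : 0 < δ) (hμ : 0 < μ)
    (Q S : ℝ → Matrix (Fin 3) (Fin 3) ℝ) (x v : ℝ → Fin 3 → ℝ)
    (hQc : ContinuousOn Q (Set.Icc t (t + δ)))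
    (hSc : ContinuousOn S (Set.Icc t (t + δ)))
    (hxc : ContinuousOn x (Set.Icc t (t + δ)))
    (hvc : ContinuousOn v (Set.Icc t (t + δ)))
    (hQ : ∀ s ∈ Set.Icc t (t + δ), SO3 (Q s))
    (hS : ∀ s ∈ Set.Icc t (t + δ), SO3 (S s))
    (hx : ∀ s ∈ Set.Icc t (t + δ), x s ≠ 0)
    (hQx : ∀ s ∈ Set.Icc t (t + δ), Q s *ᵥ x s = enorm3 (x s) • e3)
    (hpe : (1 / δ) * ∫ s in t..(t + δ),
        ((((Q s)ᵀ * S s) *ᵥ v s) ⬝ᵥ (projPerp (x s) *ᵥ (((Q s)ᵀ * S s) *ᵥ v s)))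
          / (x s ⬝ᵥ x s) ≥ μ) :
    (1 / δ) * ∫ s in t..(t + δ),
        ((Mbar ((enorm3 (x s))⁻¹ • (S s *ᵥ v s)))ᵀ
          * Mbar ((enorm3 (x s))⁻¹ • (S s *ᵥ v s))).det ≥ μ := by
  have hle : t ≤ t + δ := by linarith
  set y : ℝ → Fin 3 → ℝ := fun s => (enorm3 (x s))⁻¹ • (S s *ᵥ v s)
  have hyc : ContinuousOn y (Set.Icc t (t + δ)) := by
    refine ContinuousOn.smul ((continuous_enorm3.comp_continuousOn hxc).inv₀ fun s hs => ?_) ?_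
    · exact (Real.sqrt_pos.2 (dotProduct_self_pos (hx s hs))).ne'
    · rw [continuousOn_iff_continuous_domRestrict] at hSc hvc ⊢
      exact hSc.matrix_mulVec hvc
  have hcoord : ∀ i, ContinuousOn (fun s => y s i) (Set.Icc t (t + δ)) := continuousOn_pi.1 hyc
  have h0 := hcoord 0
  have h1 := hcoord 1
  have h2 := hcoord 2
  have hcongr : (∫ s in t..(t + δ),
      ((((Q s)ᵀ * S s) *ᵥ v s) ⬝ᵥ (projPerp (x s) *ᵥ (((Q s)ᵀ * S s) *ᵥ v s)))
        / (x s ⬝ᵥ x s)) = ∫ s in t..(t + δ), (y s 0 ^ 2 + y s 1 ^ 2) := by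
    refine intervalIntegral.integral_congr fun s hs => ?_
    rw [Set.uIcc_of_le hle] at hs
    simp only [← mulVec_mulVec]
    exact dotProduct_projPerp_div_eq (hQ s hs) (hx s hs) (hQx s hs) (S s *ᵥ v s)
  rw [hcongr] at hpe
  refine hpe.trans (mul_le_mul_of_nonneg_left ?_ (by positivity))
  simp only [det_gram_Mbar]
  refine intervalIntegral.integral_mono_on hle ?_ ?_ fun s _ => ?_
  · exact ContinuousOn.intervalIntegrable_of_Icc hle (by fun_prop)
  · exact ContinuousOn.intervalIntegrable_of_Icc (u := fun s =>
      (1 + (y s 0 ^ 2 + y s 1 ^ 2)) ^ 2 * ((1 + y s 2 ^ 2) * (y s 0 ^ 2 + y s 1 ^ 2)))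
      hle (by fun_prop)
  · change y s 0 ^ 2 + y s 1 ^ 2 ≤
      (1 + (y s 0 ^ 2 + y s 1 ^ 2)) ^ 2 * ((1 + y s 2 ^ 2) * (y s 0 ^ 2 + y s 1 ^ 2))
    rw [← mul_assoc]
    refine le_mul_of_one_le_left (by positivity) (one_le_mul_of_one_le_of_one_le ?_ ?_)
    · exact one_le_pow₀ (le_add_of_nonneg_right (by positivity))
    · exact le_add_of_nonneg_right (by positivity)
end
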